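/- Let Γ be a finite simple graph, C = A(Γ) the associated right-angled Artin group, H an arbitrary subgroup of C, and Z the center of H. Then every subgroup Z₁ ≤ Z is finitely generated, and the quotient group H / Z₁ (Z₁ is normal in H since it is central) is residually finite. -/

import Mathlib

/-- A group `K` is residually finite if every nontrivial element survives in some
finite quotient. -/
def ResiduallyFinite (K : Type*) [Group K] : Prop :=
  ∀ k : K, k ≠ 1 → ∃ (F : Type) (_ : Group F) (_ : Finite F) (f : K →* F), f k ≠ 1

/-- The set of defining relators of the right-angled Artin group on `Γ`. -/
abbrev raagRels {V : Type*} (Γ : SimpleGraph V) : Set (FreeGroup V) :=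
  {r | ∃ u v : V, Γ.Adj u v ∧
    r = FreeGroup.of u * FreeGroup.of v * (FreeGroup.of u)⁻¹ * (FreeGroup.of v)⁻¹}

/-- The right-angled Artin group associated to a simple graph `Γ`. -/
abbrev RAAG {V : Type*} (Γ : SimpleGraph V) := PresentedGroup (raagRels Γ)

universe u

namespace FreeGroup

variable {X : Type u}

theorem exists_finset_mem_closure (f : FreeGroup X) :
    ∃ S : Finset X, f ∈ Subgroup.closure (of '' (S : Set X)) := by
  classical
  induction f using FreeGroup.induction_on with
  | C1 => exact ⟨∅, one_mem _⟩
  | of x => exact ⟨{x}, Subgroup.subset_closure ⟨x, by simp, rfl⟩⟩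
  | inv_of x h => exact ⟨h.choose, inv_mem h.choose_spec⟩
  | mul f g hf hg =>
    obtain ⟨S, hS⟩ := hf
    obtain ⟨T, hT⟩ := hg
    refine ⟨S ∪ T, mul_mem (Subgroup.closure_mono ?_ hS) (Subgroup.closure_mono ?_ hT)⟩ <;>
    exact Set.image_mono (by simp)

open Classical in
/-- The endomorphism of a free group that fixes the generators in `S` and kills the others. -/
noncomputable def retract (S : Set X) : FreeGroup X →* FreeGroup X :=
  lift fun x => if x ∈ S then of x else 1

theorem retract_eq_self {S : Set X} {f : FreeGroup X}
    (hf : f ∈ Subgroup.closure (of '' S)) : retract S f = f := by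
  have h : Set.EqOn (retract S) (MonoidHom.id _) (of '' S) := by
    rintro _ ⟨x, hx, rfl⟩
    simp [retract, hx]
  exact MonoidHom.eqOn_closure h hf

theorem retract_mem_closure_inter {S T : Set X} {f : FreeGroup X}
    (hf : f ∈ Subgroup.closure (of '' T)) :
    retract S f ∈ Subgroup.closure (of '' (S ∩ T)) := by
  suffices h : Subgroup.closure (of '' T) ≤
      (Subgroup.closure (of '' (S ∩ T))).comap (retract S) from h hf
  rw [Subgroup.closure_le]
  rintro _ ⟨x, hx, rfl⟩
  by_cases hS : x ∈ S
  · have h : of x ∈ Subgroup.closure (of '' (S ∩ T)) :=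
      Subgroup.subset_closure ⟨x, ⟨hS, hx⟩, rfl⟩
    simpa [retract, hS] using h
  · simp [retract, hS]

/-- `S` carries `f` if some conjugate of `f` is a word in the generators from `S`. -/
def Carries (S : Set X) (f : FreeGroup X) : Prop :=
  ∃ u : FreeGroup X, u * f * u⁻¹ ∈ Subgroup.closure (of '' S)

theorem Carries.inter {S T : Set X} {f : FreeGroup X} (hS : Carries S f) (hT : Carries T f) :
    Carries (S ∩ T) f := by
  obtain ⟨u, hu⟩ := hS
  obtain ⟨v, hv⟩ := hT
  refine ⟨retract S v * (retract S u)⁻¹ * u, ?_⟩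
  have h := retract_mem_closure_inter (S := S) hv
  have h' := retract_eq_self hu
  simp only [_root_.map_mul, _root_.map_inv] at h h'
  convert! h using 1
  have : u * f * u⁻¹ = retract S u * retract S f * (retract S u)⁻¹ := h'.symm
  calc _ = retract S v * (retract S u)⁻¹ * (u * f * u⁻¹) * retract S u * (retract S v)⁻¹ := by group
    _ = _ := by rw [this]; group

theorem carries_conj {S : Set X} {f : FreeGroup X} (a : FreeGroup X) (h : Carries S f) :
    Carries S (a * f * a⁻¹) := by
  obtain ⟨u, hu⟩ := h
  exact ⟨u * a⁻¹, by convert! hu using 1; group⟩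

theorem Carries.map {Y : Type*} {S : Set X} {f : FreeGroup X} (h : Carries S f) (e : X → Y) :
    Carries (e '' S) (FreeGroup.map e f) := by
  obtain ⟨u, hu⟩ := h
  refine ⟨FreeGroup.map e u, ?_⟩
  have h := Subgroup.mem_map_of_mem (FreeGroup.map e) hu
  rw [MonoidHom.map_closure, Set.image_image] at h
  simpa [Set.image_image] using h

theorem exists_minimal_carrier (f : FreeGroup X) :
    ∃ S : Finset X, Carries (S : Set X) f ∧ ∀ T : Set X, Carries T f → (S : Set X) ⊆ T := by
  classical
  obtain ⟨S₀, hS₀⟩ := exists_finset_mem_closure f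
  have hex : ∃ n, ∃ S : Finset X, Carries (S : Set X) f ∧ S.card = n :=
    ⟨_, S₀, ⟨1, by simpa using hS₀⟩, rfl⟩
  obtain ⟨S, hS, hcard⟩ := Nat.find_spec hex
  refine ⟨S, hS, fun T hT x hx => ?_⟩
  by_contra hxT
  have h := hS.inter hT
  have hlt : (S.filter (· ∈ T)).card < S.card :=
    Finset.card_lt_card (Finset.filter_ssubset.2 ⟨x, hx, hxT⟩)
  refine Nat.find_min hex (hcard ▸ hlt) ⟨S.filter (· ∈ T), ?_, rfl⟩
  convert! h using 1
  ext; simp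

theorem subsingleton_of_mem_center {f : FreeGroup X} (hf : f ∈ Subgroup.center (FreeGroup X))
    (hf1 : f ≠ 1) : Subsingleton X := by
  classical
  have hne : f.toWord ≠ [] := by simpa using hf1
  obtain ⟨a, w, haw⟩ := List.exists_cons_of_ne_nil hne
  have key : ∀ c : X, c = a.1 := by
    intro c
    by_contra hc
    have hcomm := congrArg toWord (Subgroup.mem_center_iff.1 hf (of c))
    have hred : IsReduced ((c, true) :: f.toWord) := by
      have := isReduced_toWord (x := f)
      rw [haw] at this ⊢
      exact isReduced_cons_cons.2 ⟨fun h => absurd h hc, this⟩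
    rw [toWord_mul, toWord_of, List.singleton_append, hred.reduce_eq] at hcomm
    have hsub := toWord_mul_sublist f (of c)
    rw [← hcomm, toWord_of] at hsub
    have := hsub.eq_of_length (by simp)
    rw [haw] at this
    simp only [List.cons_append, List.cons.injEq] at this
    exact hc (congrArg Prod.fst this.1)
  exact ⟨fun x y => (key x).trans (key y).symm⟩

theorem subsingleton_of_commute (h : ∀ f g : FreeGroup X, Commute f g) : Subsingleton X := by
  refine ⟨fun x y => ?_⟩
  have : Subsingleton X := subsingleton_of_mem_center (f := of x)
    (Subgroup.mem_center_iff.2 fun g => h g _) (of_ne_one x)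
  exact Subsingleton.elim x y

end FreeGroup

/-- Central elements of groups mapping to `K` that survive in `K` are detected by homomorphisms
to `ℤ`. -/
def CentersDetected (K : Type u) [Group K] : Prop :=
  ∀ (H : Type u) [Group H] (ψ : H →* K) (z : H), z ∈ Subgroup.center H → ψ z ≠ 1 →
    ∃ φ : H →* Multiplicative ℤ, φ z ≠ 1

/-- Every commutative subgroup of `K` is finitely generated. -/
def CommSubgroupsFG (K : Type u) [Group K] : Prop :=
  ∀ B : Subgroup K, (∀ x ∈ B, ∀ y ∈ B, Commute x y) → B.FG

theorem exists_hom_int_of_finiteIndex {H : Type*} [Group H] (H₀ : Subgroup H) [H₀.FiniteIndex]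
    {z : H} (hz : z ∈ Subgroup.center H) (hz₀ : z ∈ H₀) (φ : H₀ →* Multiplicative ℤ)
    (hφ : φ ⟨z, hz₀⟩ ≠ 1) : ∃ φ' : H →* Multiplicative ℤ, φ' z ≠ 1 := by
  refine ⟨φ.transfer, ?_⟩
  rw [MonoidHom.transfer_eq_pow φ z fun k g _ => by
    rw [mul_assoc, ← Subgroup.mem_center_iff.1 (pow_mem hz k) g, inv_mul_cancel_left]]
  have : (⟨z ^ H₀.index, pow_mem hz₀ _⟩ : H₀) = ⟨z, hz₀⟩ ^ H₀.index := rfl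
  rw [this, map_pow]
  intro h
  exact hφ ((pow_eq_one_iff_left Subgroup.FiniteIndex.index_ne_zero).1 h)

theorem Subgroup.fg_of_fg_map_of_fg_inf_ker {G K : Type*} [Group G] [Group K] (f : G →* K)
    (B : Subgroup G) (h₁ : (B.map f).FG) (h₂ : (B ⊓ f.ker).FG) : B.FG := by
  classical
  obtain ⟨T, hT⟩ := h₁
  obtain ⟨S, hS⟩ := h₂
  have hlift : ∀ t : T, ∃ b ∈ B, f b = t := fun t =>
    hT.le (Subgroup.subset_closure t.2)
  choose l hlB hl using hlift
  rw [Subgroup.fg_iff]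
  refine ⟨S ∪ Set.range l, le_antisymm ?_ fun b hb => ?_, S.finite_toSet.union (Set.finite_range l)⟩
  · rw [Subgroup.closure_le]
    rintro x (hx | ⟨t, rfl⟩)
    · exact (hS.le (Subgroup.subset_closure hx)).1
    · exact hlB t
  · have hmap : B.map f ≤ (Subgroup.closure (Set.range l)).map f := by
      rw [← hT, Subgroup.closure_le]
      exact fun t ht => ⟨l ⟨t, ht⟩, Subgroup.subset_closure ⟨_, rfl⟩, hl _⟩
    obtain ⟨c, hc, hcb⟩ := hmap (Subgroup.mem_map_of_mem f hb)
    have hcB : c ∈ B := by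
      refine (Subgroup.closure_le B).2 ?_ hc
      rintro _ ⟨t, rfl⟩
      exact hlB t
    have hk : b * c⁻¹ ∈ B ⊓ f.ker :=
      ⟨B.mul_mem hb (B.inv_mem hcB), by simp [hcb]⟩
    rw [← hS] at hk
    rw [← inv_mul_cancel_right b c]
    exact mul_mem (Subgroup.closure_mono Set.subset_union_left hk)
      (Subgroup.closure_mono Set.subset_union_right hc)

theorem CommSubgroupsFG.of_injective {K K' : Type u} [Group K] [Group K'] (f : K →* K')
    (hf : Function.Injective f) (h : CommSubgroupsFG K') : CommSubgroupsFG K := by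
  intro B hB
  refine Subgroup.fg_of_fg_map_of_fg_inf_ker f B (h _ ?_) ?_
  · rintro _ ⟨x, hx, rfl⟩ _ ⟨y, hy, rfl⟩
    exact (hB x hx y hy).map f
  · rw [(MonoidHom.ker_eq_bot_iff f).2 hf, inf_bot_eq]
    exact Subgroup.FG.bot

theorem CentersDetected.of_injective {K K' : Type u} [Group K] [Group K'] (f : K →* K')
    (hf : Function.Injective f) (h : CentersDetected K') : CentersDetected K :=
  fun H _ ψ z hz hψ => h H (f.comp ψ) z hz fun h1 => hψ (hf (h1.trans (map_one f).symm))

theorem Group.ResiduallyFinite.of_injective {K K' : Type*} [Group K] [Group K'] (f : K →* K')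
    (hf : Function.Injective f) (h : Group.ResiduallyFinite K') : Group.ResiduallyFinite K := by
  rw [Group.residuallyFinite_iff_exists_finiteIndexNormalSubgroup] at h ⊢
  intro g hg
  obtain ⟨N, hgN⟩ := h (f g) fun h1 => hg (hf (h1.trans (map_one f).symm))
  exact ⟨N.comap f, hgN⟩

namespace FreeGroup

variable {X : Type u}

theorem centersDetected : CentersDetected (FreeGroup X) := by
  intro H _ ψ z hz hψ
  let P := ψ.range
  let e : P ≃* FreeGroup (IsFreeGroup.Generators P) := IsFreeGroup.toFreeGroup P
  let θ : H →* FreeGroup (IsFreeGroup.Generators P) := e.toMonoidHom.comp ψ.rangeRestrict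
  have hθs : Function.Surjective θ := e.surjective.comp ψ.rangeRestrict_surjective
  have hθz : θ z ≠ 1 := by
    intro h
    apply hψ
    have : ψ.rangeRestrict z = 1 := e.injective (h.trans (_root_.map_one e).symm)
    exact congrArg Subtype.val this
  have hcen : θ z ∈ Subgroup.center _ := by
    rw [Subgroup.mem_center_iff]
    intro g
    obtain ⟨h, rfl⟩ := hθs g
    rw [← _root_.map_mul, ← _root_.map_mul, Subgroup.mem_center_iff.1 hz h]
  have := subsingleton_of_mem_center hcen hθz
  cases isEmpty_or_nonempty (IsFreeGroup.Generators P) with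
  | inl _ => exact absurd (Subsingleton.elim _ _) hθz
  | inr h =>
    have : Inhabited (IsFreeGroup.Generators P) := ⟨h.some⟩
    have := Unique.mk' (IsFreeGroup.Generators P)
    exact ⟨(mulEquivIntOfUnique (α := IsFreeGroup.Generators P)).toMonoidHom.comp θ,
      fun h => hθz ((mulEquivIntOfUnique (α := IsFreeGroup.Generators P)).injective
        (h.trans (_root_.map_one _).symm))⟩

theorem commSubgroupsFG : CommSubgroupsFG (FreeGroup X) := by
  intro B hB
  let e : FreeGroup (IsFreeGroup.Generators B) ≃* B := (IsFreeGroup.toFreeGroup B).symm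
  have : Subsingleton (IsFreeGroup.Generators B) := subsingleton_of_commute fun f g =>
    e.injective (by
      rw [_root_.map_mul, _root_.map_mul]
      exact Subtype.ext (hB _ (e f).2 _ (e g).2))
  rw [← Group.fg_iff_subgroup_fg]
  exact Group.fg_of_surjective e.surjective (f := e.toMonoidHom)

/-- Free groups are residually finite: the generators act partially by left multiplication on the
suffixes of the reduced word of `f`, and this partial action extends to one by permutations. -/
theorem exists_finite_hom {f : FreeGroup X} (hf : f ≠ 1) :
    ∃ (E : Type u) (_ : Group E) (_ : Finite E) (σ : FreeGroup X →* E), σ f ≠ 1 := by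
  classical
  let A : Set (FreeGroup X) := (fun L => mk L) '' {L | L <:+ f.toWord}
  have hA : A.Finite := by
    refine Set.Finite.image _ ((List.finite_toSet f.toWord.tails).subset fun L hL => ?_)
    simpa using hL
  have : Finite A := hA.to_subtype
  have h1 : (1 : FreeGroup X) ∈ A := ⟨[], List.nil_suffix, rfl⟩
  have hmem {L : List (X × Bool)} (hL : L <:+ f.toWord) : mk L ∈ A := ⟨L, hL, rfl⟩
  let e (x : X) : {a : A // of x * a.1 ∈ A} ≃ {a : A // (of x)⁻¹ * a.1 ∈ A} :=
    { toFun a := ⟨⟨of x * a.1.1, a.2⟩, by simp⟩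
      invFun a := ⟨⟨(of x)⁻¹ * a.1.1, a.2⟩, by simp⟩
      left_inv a := by simp
      right_inv a := by simp }
  let σ : FreeGroup X →* Equiv.Perm A := lift fun x => (e x).extendSubtype
  have hσ (x : X) (a : A) (h : of x * a.1 ∈ A) : σ (of x) a = ⟨of x * a.1, h⟩ := by
    simp only [σ, lift_apply_of]
    exact (e x).extendSubtype_apply_of_mem a h
  have hσ' (x : X) (a : A) (h : (of x)⁻¹ * a.1 ∈ A) : σ (of x)⁻¹ a = ⟨(of x)⁻¹ * a.1, h⟩ := by
    rw [_root_.map_inv, Equiv.Perm.inv_eq_iff_eq, hσ x _ (by simp)]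
    simp
  have key : ∀ L : List (X × Bool), ∀ hL : L <:+ f.toWord,
      ((σ (mk L) ⟨1, h1⟩ : A) : FreeGroup X) = mk L := by
    intro L
    induction L with
    | nil => intro hL; rw [← one_eq_mk, _root_.map_one, Equiv.Perm.one_apply]
    | cons p L ih =>
      intro hL
      have hL' : L <:+ f.toWord := (List.suffix_cons p L).trans hL
      obtain ⟨x, b⟩ := p
      cases b with
      | true =>
        have h : mk ((x, true) :: L) = of x * mk L := by simp [of]
        have hm : of x * mk L ∈ A := h ▸ hmem hL
        rw [h, _root_.map_mul, Equiv.Perm.mul_apply, hσ x _ (by rwa [ih hL'])]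
        exact congrArg (of x * ·) (ih hL')
      | false =>
        have h : mk ((x, false) :: L) = (of x)⁻¹ * mk L := by simp [of, inv_mk, invRev]
        have hm : (of x)⁻¹ * mk L ∈ A := h ▸ hmem hL
        rw [h, _root_.map_mul, Equiv.Perm.mul_apply, hσ' x _ (by rwa [ih hL'])]
        exact congrArg ((of x)⁻¹ * ·) (ih hL')
  refine ⟨Equiv.Perm A, inferInstance, inferInstance, σ, fun h => hf ?_⟩
  have := key f.toWord List.suffix_rfl
  simp only [mk_toWord, h, Equiv.Perm.one_apply] at this
  exact this.symm

end FreeGroup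

section PermutationalProduct

variable {G X : Type u} [Group G] [MulAction G X]

variable (G X) in
/-- The action of `G` on the free group on a `G`-set by permuting the generators. -/
def permAut : G →* MulAut (FreeGroup X) where
  toFun g := FreeGroup.freeGroupCongr (MulAction.toPerm g)
  map_one' := by
    ext f
    simp [MulAction.toPerm]
  map_mul' g h := by
    ext f
    have h : (MulAction.toPerm (g * h) : X → X) = fun x => g • h • x := funext (mul_smul g h)
    simp [MulAut.mul_apply, FreeGroup.map.comp, Function.comp_def, h]

theorem permAut_apply (g : G) (f : FreeGroup X) :
    permAut G X g f = FreeGroup.map (fun x => g • x) f := rfl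

theorem retract_permAut {S : Set X} {g : G} (hg : ∀ x ∈ S, g • x = x) (f : FreeGroup X) :
    FreeGroup.retract S (permAut G X g f) = FreeGroup.retract S f := by
  suffices h : (FreeGroup.retract S).comp (permAut G X g).toMonoidHom = FreeGroup.retract S from
    DFunLike.congr_fun h f
  ext x
  have hx : g • x ∈ S ↔ x ∈ S := by
    refine ⟨fun h => ?_, fun h => (hg x h).symm ▸ h⟩
    have := smul_left_cancel g (hg _ h)
    exact this ▸ h
  by_cases h : x ∈ S
  · simp [permAut_apply, FreeGroup.retract, h, hg x h]
  · simp [permAut_apply, FreeGroup.retract, h, hx]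

open SemidirectProduct

theorem commSubgroupsFG_semidirectProduct (hG : CommSubgroupsFG G) :
    CommSubgroupsFG (FreeGroup X ⋊[permAut G X] G) := by
  intro B hB
  refine Subgroup.fg_of_fg_map_of_fg_inf_ker rightHom B (hG _ ?_) ?_
  · rintro _ ⟨x, hx, rfl⟩ _ ⟨y, hy, rfl⟩
    exact (hB x hx y hy).map _
  · have h : B ⊓ rightHom.ker = (B.comap inl).map (inl : FreeGroup X →* _ ⋊[permAut G X] G) := by
      rw [Subgroup.map_comap_eq, range_inl_eq_ker_rightHom, inf_comm]
    rw [h]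
    have hfg : (B.comap (inl : FreeGroup X →* _ ⋊[permAut G X] G)).FG := by
      refine FreeGroup.commSubgroupsFG _ fun x hx y hy => ?_
      exact inl_injective (by rw [map_mul, map_mul]; exact hB _ hx _ hy)
    rw [Subgroup.fg_iff_submonoid_fg] at hfg ⊢
    exact hfg.map inl

theorem centersDetected_semidirectProduct (hG : CentersDetected G) :
    CentersDetected (FreeGroup X ⋊[permAut G X] G) := by
  intro H _ ψ z hz hψ
  by_cases hzr : rightHom (ψ z) = 1
  swap
  · exact hG H (rightHom.comp ψ) z hz hzr
  obtain ⟨f, hf⟩ : ∃ f, inl f = ψ z := by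
    have : ψ z ∈ (rightHom : FreeGroup X ⋊[permAut G X] G →* G).ker := hzr
    rwa [← range_inl_eq_ker_rightHom] at this
  have hf1 : f ≠ 1 := fun h => hψ (by rw [← hf, h, map_one])
  let γ : H →* G := rightHom.comp ψ
  have hγ (h : H) : (ψ h).left * permAut G X (γ h) f * ((ψ h).left)⁻¹ = f := by
    have h1 : ψ h * inl f = inl f * ψ h := by
      rw [hf, ← map_mul, ← map_mul, Subgroup.mem_center_iff.1 hz h]
    have h2 := congrArg SemidirectProduct.left h1
    simp only [mul_left, left_inl, right_inl, map_one, MulAut.one_apply] at h2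
    rw [mul_inv_eq_iff_eq_mul]
    exact h2
  obtain ⟨S, hS, hSmin⟩ := FreeGroup.exists_minimal_carrier f
  let _ : MulAction H X := MulAction.compHom X γ
  have hsmul (h : H) (x : X) : h • x = γ h • x := rfl
  have hsub (h : H) : (S : Set X) ⊆ (fun x => h • x) '' (S : Set X) := by
    refine hSmin _ ?_
    have h1 := FreeGroup.carries_conj (ψ h).left (hS.map fun x => γ h • x)
    rw [← permAut_apply, hγ] at h1
    exact h1
  have hstab (h : H) {x : X} (hx : x ∈ S) : h • x ∈ S := by
    obtain ⟨y, hy, hxy⟩ := hsub h⁻¹ hx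
    have : h • x = y := by rw [← hxy, smul_inv_smul]
    exact this ▸ hy
  let H₀ : Subgroup H := ⨅ x ∈ S, MulAction.stabilizer H x
  have hH₀ : H₀.FiniteIndex := Subgroup.finiteIndex_iInf' _ fun x hx => ⟨by
    rw [MulAction.index_stabilizer]
    have hfin : (MulAction.orbit H x).Finite := S.finite_toSet.subset (by
      rintro _ ⟨h, rfl⟩
      exact hstab h hx)
    exact (Set.ncard_pos hfin).2 ⟨x, MulAction.mem_orbit_self x⟩ |>.ne'⟩
  have hfix (h : H₀) : ∀ x ∈ (S : Set X), γ h • x = x := fun x hx => by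
    have := h.2
    simp only [H₀, Subgroup.mem_iInf, MulAction.mem_stabilizer_iff] at this
    exact this x hx
  have hz₀ : z ∈ H₀ := by
    simp only [H₀, Subgroup.mem_iInf, MulAction.mem_stabilizer_iff]
    intro x _
    rw [hsmul, show γ z = 1 from hzr, one_smul]
  let θ : H₀ →* FreeGroup X :=
    { toFun h := FreeGroup.retract S (ψ h).left
      map_one' := by simp
      map_mul' a b := by
        rw [Subgroup.coe_mul, map_mul, mul_left, map_mul]
        congr 1
        exact retract_permAut (hfix a) _ }
  have hθ : θ ⟨z, hz₀⟩ ≠ 1 := by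
    have h1 : θ ⟨z, hz₀⟩ = FreeGroup.retract S f := by
      change FreeGroup.retract S (ψ z).left = _
      rw [← hf, left_inl]
    rw [h1]
    intro h2
    obtain ⟨u, hu⟩ := hS
    have h3 := FreeGroup.retract_eq_self hu
    rw [map_mul, map_mul, h2, mul_one, map_inv, mul_inv_cancel] at h3
    exact hf1 (by simpa using h3.symm)
  have hc : (⟨z, hz₀⟩ : H₀) ∈ Subgroup.center H₀ :=
    Subgroup.mem_center_iff.2 fun h => Subtype.ext (Subgroup.mem_center_iff.1 hz h)
  obtain ⟨φ, hφ⟩ := FreeGroup.centersDetected H₀ θ _ hc hθ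
  exact exists_hom_int_of_finiteIndex H₀ hz hz₀ φ hφ

/-- Residual finiteness of `FreeGroup X ⋊ G` when elements of the `G`-set `X` are separated in
finite quotients. -/
theorem residuallyFinite_semidirectProduct (hG : Group.ResiduallyFinite G)
    (hX : ∀ S : Finset X, ∃ (Q Y : Type u) (_ : Group Q) (_ : Finite Q) (_ : MulAction Q Y)
      (q : G →* Q) (j : X → Y), (∀ g x, j (g • x) = q g • j x) ∧ Set.InjOn j S) :
    Group.ResiduallyFinite (FreeGroup X ⋊[permAut G X] G) := by
  classical
  rw [Group.residuallyFinite_iff_exists_finiteIndexNormalSubgroup] at hG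
  rw [Group.residuallyFinite_iff_exists_finiteIndex]
  intro k hk
  by_cases hkr : rightHom k = 1
  swap
  · obtain ⟨N, hN⟩ := hG _ hkr
    exact ⟨(N.comap rightHom).toSubgroup, inferInstance, hN⟩
  obtain ⟨f, rfl⟩ : ∃ f, inl f = k := by
    have : k ∈ (rightHom : FreeGroup X ⋊[permAut G X] G →* G).ker := hkr
    rwa [← range_inl_eq_ker_rightHom] at this
  have hf1 : f ≠ 1 := fun h => hk (by rw [h, map_one])
  obtain ⟨E, _, _, σ, hσ⟩ := FreeGroup.exists_finite_hom hf1
  obtain ⟨S, hS⟩ := FreeGroup.exists_finset_mem_closure f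
  obtain ⟨Q, Y, _, _, _, q, j, hj, hinj⟩ := hX S
  let σ' : FreeGroup Y →* E := FreeGroup.lift fun y =>
    if h : ∃ x ∈ S, j x = y then σ (FreeGroup.of h.choose) else 1
  have hσ' : σ' (FreeGroup.map j f) = σ f := by
    have h : Set.EqOn (σ'.comp (FreeGroup.map j)) σ (FreeGroup.of '' (S : Set X)) := by
      rintro _ ⟨x, hx, rfl⟩
      have h : ∃ x' ∈ S, j x' = j x := ⟨x, hx, rfl⟩
      have h' : h.choose = x := hinj h.choose_spec.1 hx h.choose_spec.2
      simp [σ', dif_pos h, h']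
    exact MonoidHom.eqOn_closure h hS
  let p : FreeGroup X ⋊[permAut G X] G →* FreeGroup Y ⋊[permAut Q Y] Q :=
    SemidirectProduct.map (FreeGroup.map j) q fun g => by
      ext x
      simp [permAut_apply, hj]
  let N : Subgroup (FreeGroup Y ⋊[permAut Q Y] Q) := σ'.ker.map inl
  have hN : N.FiniteIndex := ⟨by
    rw [Subgroup.index_map]
    have : (σ'.ker ⊔ (inl : FreeGroup Y →* FreeGroup Y ⋊[permAut Q Y] Q).ker).FiniteIndex :=
      Subgroup.finiteIndex_of_le le_sup_left
    have h2 : (inl : FreeGroup Y →* FreeGroup Y ⋊[permAut Q Y] Q).range.FiniteIndex := by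
      rw [range_inl_eq_ker_rightHom]
      infer_instance
    exact mul_ne_zero Subgroup.FiniteIndex.index_ne_zero Subgroup.FiniteIndex.index_ne_zero⟩
  refine ⟨N.normalCore.comap p, ?_, fun h => ?_⟩
  · exact ((FiniteIndexNormalSubgroup.ofSubgroup N.normalCore).comap p).isFiniteIndex'
  · obtain ⟨w, hw, hwf⟩ := N.normalCore_le h
    have h1 : p (inl f) = inl (FreeGroup.map j f) := SemidirectProduct.map_inl ..
    have h2 := inl_injective (hwf.trans h1)
    exact hσ (by rw [← hσ', ← h2]; exact hw)

end PermutationalProduct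

namespace RAAG

variable {V : Type u} {Γ : SimpleGraph V}

/-- The standard generators of a right-angled Artin group. -/
def of (Γ : SimpleGraph V) (v : V) : RAAG Γ := PresentedGroup.of v

/-- The homomorphism from a right-angled Artin group given by the images of the generators. -/
def lift {K : Type*} [Group K] (f : V → K) (hf : ∀ u v, Γ.Adj u v → Commute (f u) (f v)) :
    RAAG Γ →* K :=
  PresentedGroup.toGroup (f := f) (by
    rintro _ ⟨u, v, h, rfl⟩
    simp [(hf u v h).eq])

@[simp]
theorem lift_of {K : Type*} [Group K] (f : V → K)
    (hf : ∀ u v, Γ.Adj u v → Commute (f u) (f v)) (v : V) : lift f hf (of Γ v) = f v :=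
  PresentedGroup.toGroup.of _

theorem commute_of {u v : V} (h : Γ.Adj u v) : Commute (of Γ u) (of Γ v) := by
  have h1 : (PresentedGroup.mk (raagRels Γ)) (FreeGroup.of u * FreeGroup.of v *
      (FreeGroup.of u)⁻¹ * (FreeGroup.of v)⁻¹) = 1 :=
    (QuotientGroup.eq_one_iff _).2 (Subgroup.subset_normalClosure ⟨u, v, h, rfl⟩)
  simp only [map_mul, map_inv] at h1
  exact (mul_inv_eq_iff_eq_mul.1 (mul_inv_eq_one.1 h1))

theorem hom_ext {K : Type*} [Group K] {f g : RAAG Γ →* K}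
    (h : ∀ v, f (of Γ v) = g (of Γ v)) : f = g :=
  PresentedGroup.ext h

section Decomposition

variable (Γ) (v : V)

/-- The right-angled Artin group on the vertices different from `v`. -/
abbrev Away := RAAG (Γ.induce {w | w ≠ v})

open Classical in
/-- The retraction of `Away Γ v` onto the subgroup generated by the neighbours of `v`. -/
noncomputable def linkRetract : Away Γ v →* Away Γ v :=
  lift (fun w => if Γ.Adj w v then of _ w else 1) (by
    intro a b hab
    have := commute_of hab
    split_ifs <;> simp [this])

theorem linkRetract_linkRetract (g : Away Γ v) :
    linkRetract Γ v (linkRetract Γ v g) = linkRetract Γ v g := by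
  refine DFunLike.congr_fun (f := (linkRetract Γ v).comp (linkRetract Γ v)) (hom_ext fun w => ?_) g
  by_cases h : Γ.Adj w v <;> simp [linkRetract, h]

/-- The subgroup of `Away Γ v` generated by the neighbours of `v`. -/
noncomputable abbrev link : Subgroup (Away Γ v) := (linkRetract Γ v).range

variable {Γ v} in
theorem mem_link_iff {g : Away Γ v} : g ∈ link Γ v ↔ linkRetract Γ v g = g := by
  refine ⟨?_, fun h => ⟨g, h⟩⟩
  rintro ⟨h, rfl⟩
  exact linkRetract_linkRetract Γ v h

/-- The free-by-`Away Γ v` group into which the right-angled Artin group on `Γ` embeds. -/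
abbrev Splitting := FreeGroup (Away Γ v ⧸ link Γ v) ⋊[permAut (Away Γ v) (Away Γ v ⧸ link Γ v)]
  (Away Γ v)

open SemidirectProduct

open Classical in
/-- The images of the generators under the embedding of the right-angled Artin group. -/
noncomputable def splittingGen (w : V) : Splitting Γ v :=
  if h : w = v then inl (FreeGroup.of (QuotientGroup.mk 1)) else inr (of _ ⟨w, h⟩)

theorem commute_inr_inl_of {g : Away Γ v} (hg : g ∈ link Γ v) :
    Commute (inr g : Splitting Γ v) (inl (FreeGroup.of (QuotientGroup.mk 1))) := by
  have h := inl_aut (φ := permAut (Away Γ v) (Away Γ v ⧸ link Γ v)) g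
    (FreeGroup.of (QuotientGroup.mk 1))
  have h1 : permAut (Away Γ v) (Away Γ v ⧸ link Γ v) g (FreeGroup.of (QuotientGroup.mk 1)) =
      FreeGroup.of (QuotientGroup.mk 1) := by
    rw [permAut_apply, FreeGroup.map.of]
    congr 1
    rw [MulAction.Quotient.smul_mk, QuotientGroup.eq]
    simpa using hg
  rw [h1, map_inv] at h
  exact (eq_mul_inv_iff_mul_eq.1 h).symm

theorem of_mem_link {w : V} (hw : w ≠ v) (h : Γ.Adj w v) :
    of (Γ.induce {w | w ≠ v}) ⟨w, hw⟩ ∈ link Γ v :=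
  mem_link_iff.2 (by simp [linkRetract, h])

/-- The embedding of the right-angled Artin group on `Γ` into `Splitting Γ v`. -/
noncomputable def toSplitting : RAAG Γ →* Splitting Γ v :=
  lift (splittingGen Γ v) (by
    intro a b hab
    by_cases ha : a = v
    · by_cases hb : b = v
      · exact absurd (ha.trans hb.symm) hab.ne
      · subst ha
        simpa [splittingGen, hb] using (commute_inr_inl_of Γ a (of_mem_link Γ a hb hab.symm)).symm
    · by_cases hb : b = v
      · subst hb
        simpa [splittingGen, ha] using commute_inr_inl_of Γ b (of_mem_link Γ b ha hab)
      · have h : (Γ.induce {w | w ≠ v}).Adj ⟨a, ha⟩ ⟨b, hb⟩ := hab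
        simpa [splittingGen, ha, hb] using (commute_of h).map inr)

/-- The homomorphism induced by the inclusion of the vertices different from `v`. -/
def awayInclusion : Away Γ v →* RAAG Γ :=
  lift (fun w => of Γ w) fun _ _ h => commute_of h

theorem commute_awayInclusion_linkRetract (g : Away Γ v) :
    Commute (awayInclusion Γ v (linkRetract Γ v g)) (of Γ v) := by
  have h : ∀ g : Away Γ v,
      g ∈ (Subgroup.centralizer {of Γ v}).comap ((awayInclusion Γ v).comp (linkRetract Γ v)) := by
    refine PresentedGroup.generated_by _ _ fun w => ?_
    change awayInclusion Γ v (linkRetract Γ v (of _ w)) ∈ Subgroup.centralizer {of Γ v}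
    by_cases h : Γ.Adj w v
    · simpa [linkRetract, h, awayInclusion, Subgroup.mem_centralizer_singleton_iff] using
        (commute_of h).eq
    · simp [linkRetract, h, one_mem]
  exact Subgroup.mem_centralizer_singleton_iff.1 (h g)

/-- The conjugates of the generator `v`, indexed by the cosets of the link. -/
noncomputable def conjGen : Away Γ v ⧸ link Γ v → RAAG Γ :=
  Quotient.lift (fun g => awayInclusion Γ v g * of Γ v * (awayInclusion Γ v g)⁻¹) (by
    intro a b hab
    have h : a⁻¹ * b ∈ link Γ v := QuotientGroup.leftRel_apply.1 hab
    have hc := commute_awayInclusion_linkRetract Γ v (a⁻¹ * b)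
    rw [mem_link_iff.1 h] at hc
    have hb : b = a * (a⁻¹ * b) := by group
    generalize a⁻¹ * b = c at *
    subst hb
    simp only [map_mul, mul_inv_rev]
    calc _ = awayInclusion Γ v a * (of Γ v * awayInclusion Γ v c) * (awayInclusion Γ v c)⁻¹ *
          (awayInclusion Γ v a)⁻¹ := by group
      _ = _ := by rw [← hc.eq]; group)

/-- The left inverse of `toSplitting`. -/
noncomputable def ofSplitting : Splitting Γ v →* RAAG Γ :=
  SemidirectProduct.lift (FreeGroup.lift (conjGen Γ v)) (awayInclusion Γ v) (by
    intro g
    ext x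
    induction x using QuotientGroup.induction_on with
    | H a =>
    simp only [MonoidHom.comp_apply, MulEquiv.coe_toMonoidHom, permAut_apply, FreeGroup.map.of,
      FreeGroup.lift_apply_of, MulAut.conj_apply]
    change awayInclusion Γ v (g * a) * _ * (awayInclusion Γ v (g * a))⁻¹ =
      _ * (awayInclusion Γ v a * _ * (awayInclusion Γ v a)⁻¹) * _
    rw [map_mul]
    group)

theorem toSplitting_injective : Function.Injective (toSplitting Γ v) := by
  have h : (ofSplitting Γ v).comp (toSplitting Γ v) = MonoidHom.id _ := by
    refine hom_ext fun w => ?_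
    by_cases hw : w = v
    · subst hw
      simp only [MonoidHom.comp_apply, toSplitting, lift_of, splittingGen, dif_pos, ofSplitting,
        SemidirectProduct.lift_inl, FreeGroup.lift_apply_of]
      change awayInclusion Γ w 1 * _ * (awayInclusion Γ w 1)⁻¹ = _
      simp
    · simp [toSplitting, splittingGen, hw, ofSplitting, awayInclusion]
  exact Function.LeftInverse.injective (g := ofSplitting Γ v) (DFunLike.congr_fun h)

theorem residuallyFinite_of_away (h : Group.ResiduallyFinite (Away Γ v)) :
    Group.ResiduallyFinite (RAAG Γ) := by
  classical
  refine Group.ResiduallyFinite.of_injective _ (toSplitting_injective Γ v)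
    (residuallyFinite_semidirectProduct h fun S => ?_)
  rw [Group.residuallyFinite_iff_exists_finiteIndexNormalSubgroup] at h
  have hsep : ∀ p : S × S, ∃ N : FiniteIndexNormalSubgroup (Away Γ v), p.1 ≠ p.2 →
      (p.1.1.out⁻¹ * p.2.1.out)⁻¹ * linkRetract Γ v (p.1.1.out⁻¹ * p.2.1.out) ∉ N := by
    intro p
    by_cases hp : p.1 = p.2
    · exact ⟨.ofSubgroup ⊤, fun h => absurd hp h⟩
    · have hne : (p.1.1.out⁻¹ * p.2.1.out)⁻¹ * linkRetract Γ v (p.1.1.out⁻¹ * p.2.1.out) ≠ 1 := by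
        intro h1
        refine hp (Subtype.ext ?_)
        have h2 := mem_link_iff.2 (inv_mul_eq_one.1 h1).symm
        rw [← QuotientGroup.eq, QuotientGroup.out_eq', QuotientGroup.out_eq'] at h2
        exact h2
      obtain ⟨N, hN⟩ := h _ hne
      exact ⟨N, fun _ => hN⟩
  choose N hN using hsep
  let P := ∀ p : S × S, Away Γ v ⧸ (N p).toSubgroup
  let q₁ : Away Γ v →* P := MonoidHom.pi fun p => QuotientGroup.mk' _
  let q : Away Γ v →* P × P := q₁.prod (q₁.comp (linkRetract Γ v))
  let j : Away Γ v ⧸ link Γ v → (P × P) ⧸ (link Γ v).map q :=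
    Quotient.map' q fun a b hab => by
      rw [QuotientGroup.leftRel_apply] at hab ⊢
      rw [← map_inv, ← map_mul]
      exact Subgroup.mem_map_of_mem _ hab
  have : ∀ p, Finite (Away Γ v ⧸ (N p).toSubgroup) := fun p => inferInstance
  have : Finite P := Pi.finite
  refine ⟨P × P, (P × P) ⧸ (link Γ v).map q, inferInstance, inferInstance, inferInstance, q, j,
    ?_, ?_⟩
  · intro g x
    induction x using QuotientGroup.induction_on with
    | H a => exact congrArg QuotientGroup.mk (map_mul q g a)
  · intro a ha b hb hab
    by_contra hne
    refine hN (⟨a, ha⟩, ⟨b, hb⟩) (fun h => hne (congrArg Subtype.val h)) ?_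
    have h1 : (q a.out)⁻¹ * q b.out ∈ (link Γ v).map q := by
      rw [← QuotientGroup.eq]
      rw [← QuotientGroup.out_eq' a, ← QuotientGroup.out_eq' b] at hab
      exact hab
    obtain ⟨l, hl, hlq⟩ := h1
    rw [← map_inv, ← map_mul] at hlq
    have h2 : q₁ l = q₁ (a.out⁻¹ * b.out) := congrArg Prod.fst hlq
    have h3 : q₁ (linkRetract Γ v l) = q₁ (linkRetract Γ v (a.out⁻¹ * b.out)) :=
      congrArg Prod.snd hlq
    rw [mem_link_iff.1 hl, h2] at h3
    exact QuotientGroup.eq.1 (congrFun h3 (⟨a, ha⟩, ⟨b, hb⟩))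

end Decomposition

end RAAG

namespace RAAG

theorem residuallyFinite_and_commSubgroupsFG_and_centersDetected (n : ℕ) :
    ∀ {V : Type u} [Finite V] (Γ : SimpleGraph V), Nat.card V = n →
      Group.ResiduallyFinite (RAAG Γ) ∧ CommSubgroupsFG (RAAG Γ) ∧
        CentersDetected (RAAG Γ) := by
  induction n with
  | zero =>
    intro V _ Γ hV
    have : IsEmpty V :=
      (Nat.card_eq_zero.1 hV).resolve_right (not_infinite_iff_finite.2 inferInstance)
    have hf : Function.Injective (1 : RAAG Γ →* FreeGroup V) := by
      have h : MonoidHom.id (RAAG Γ) = 1 := hom_ext fun v => isEmptyElim v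
      intro a b _
      exact (DFunLike.congr_fun h a).trans (DFunLike.congr_fun h b).symm
    refine ⟨?_, .of_injective _ hf FreeGroup.commSubgroupsFG,
      .of_injective _ hf FreeGroup.centersDetected⟩
    rw [Group.residuallyFinite_iff_exists_finiteIndexNormalSubgroup]
    exact fun g hg => absurd (hf (a₁ := g) (a₂ := 1) rfl) hg
  | succ n ih =>
    intro V _ Γ hV
    have : Nonempty V := (Nat.card_pos_iff.1 (by omega)).1
    let v := Classical.arbitrary V
    have hcard : Nat.card ({w | w ≠ v} : Set V) = n := by
      have h := Set.ncard_add_ncard_compl {v}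
      rw [Set.ncard_singleton, hV] at h
      change Set.ncard {v}ᶜ = n
      omega
    obtain ⟨h₁, h₂, h₃⟩ := ih (Γ.induce {w | w ≠ v}) hcard
    exact ⟨residuallyFinite_of_away Γ v h₁,
      .of_injective _ (toSplitting_injective Γ v) (commSubgroupsFG_semidirectProduct h₂),
      .of_injective _ (toSplitting_injective Γ v) (centersDetected_semidirectProduct h₃)⟩

end RAAG

theorem exists_finite_hom_ne_one {K P : Type*} [Group K] [Group P] [Finite P] (f : K →* P) {k : K}
    (hk : f k ≠ 1) : ∃ (F : Type) (_ : Group F) (_ : Finite F) (f : K →* F), f k ≠ 1 := by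
  obtain ⟨F, _, _, ⟨e⟩⟩ := Finite.exists_type_univ_nonempty_mulEquiv.{_, 0} P
  exact ⟨F, inferInstance, inferInstance, e.toMonoidHom.comp f, by simpa using hk⟩

theorem exists_finite_hom_ne_one_of_fg {A : Type*} [CommGroup A] [Group.FG A] {a : A}
    (ha : a ≠ 1) : ∃ (F : Type) (_ : Group F) (_ : Finite F) (f : A →* F), f a ≠ 1 := by
  obtain ⟨ι, j, _, _, p, hp, e, ⟨eq⟩⟩ := CommGroup.equiv_free_prod_prod_multiplicative_zmod A
  have h : eq a ≠ 1 := by simpa using ha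
  by_cases h1 : (eq a).1 = 1
  · have h2 : (eq a).2 ≠ 1 := fun h2 => h (Prod.ext h1 h2)
    obtain ⟨i, hi⟩ := Function.ne_iff.1 h2
    have : NeZero (p i ^ e i) := ⟨pow_ne_zero _ (hp i).ne_zero⟩
    have : Finite (Multiplicative (ZMod (p i ^ e i))) := Finite.of_equiv _ Multiplicative.ofAdd
    exact ⟨_, inferInstance, this, (Pi.evalMonoidHom _ i).comp ((MonoidHom.snd _ _).comp
      eq.toMonoidHom), hi⟩
  · obtain ⟨i, hi⟩ := Function.ne_iff.1 h1
    let m : ℤ := ((eq a).1 i).toAdd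
    have hm : m ≠ 0 := hi
    have : NeZero (m.natAbs + 1) := ⟨by omega⟩
    have : Finite (Multiplicative (ZMod (m.natAbs + 1))) :=
      Finite.of_equiv _ Multiplicative.ofAdd
    refine ⟨_, inferInstance, this, (AddMonoidHom.toMultiplicative
      (Int.castAddHom (ZMod (m.natAbs + 1)))).comp ((Pi.evalMonoidHom _ i).comp
        ((MonoidHom.fst _ _).comp eq.toMonoidHom)), fun h0 => ?_⟩
    have h3 : (m : ZMod (m.natAbs + 1)) = 0 := h0
    rw [ZMod.intCast_zmod_eq_zero_iff_dvd] at h3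
    exact hm (Int.eq_zero_of_abs_lt_dvd h3 (by push_cast; omega))

open scoped IsMulCommutative in
theorem exists_hom_pi_int_injOn_center {G : Type u} [Group G] (hZ : (Subgroup.center G).FG)
    (h : ∀ z ∈ Subgroup.center G, z ≠ 1 → ∃ φ : G →* Multiplicative ℤ, φ z ≠ 1) :
    ∃ (ι : Type u) (_ : Finite ι) (Φ : G →* (ι → Multiplicative ℤ)),
      ∀ z ∈ Subgroup.center G, Φ z = 1 → z = 1 := by
  let Z := Subgroup.center G
  have : Group.FG Z := (Group.fg_iff_subgroup_fg Z).2 hZ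
  have : Module.Finite ℤ (Additive Z) := Module.Finite.iff_addGroup_fg.2 inferInstance
  let res (φ : G →* Multiplicative ℤ) : Module.Dual ℤ (Additive Z) :=
    (MonoidHom.toAdditiveLeft (φ.comp Z.subtype)).toIntLinearMap
  obtain ⟨s, hs, hspan⟩ := Submodule.fg_span_iff_fg_span_finset_subset (Set.range res) |>.1
    (IsNoetherian.noetherian (Submodule.span ℤ (Set.range res)))
  choose φ hφ using fun i : s => hs i.2
  refine ⟨s, inferInstance, MonoidHom.pi φ, fun z hz h1 => by_contra fun hne => ?_⟩
  obtain ⟨ψ, hψ⟩ := h z hz hne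
  have h2 : res ψ ∈ Submodule.span ℤ (s : Set (Module.Dual ℤ (Additive Z))) :=
    hspan ▸ Submodule.subset_span ⟨ψ, rfl⟩
  have h3 : Submodule.span ℤ (s : Set (Module.Dual ℤ (Additive Z))) ≤
      LinearMap.ker (Module.Dual.eval ℤ (Additive Z) (Additive.ofMul ⟨z, hz⟩)) := by
    refine Submodule.span_le.2 fun x hx => ?_
    have h4 : φ ⟨x, hx⟩ z = 1 := congrFun h1 ⟨x, hx⟩
    have h5 : res (φ ⟨x, hx⟩) = x := hφ ⟨x, hx⟩
    change x (Additive.ofMul ⟨z, hz⟩) = 0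
    rw [← h5]
    exact h4
  exact hψ (h3 h2)

theorem residuallyFinite_quotient_of_le_center {G : Type u} [Group G]
    (hG : Group.ResiduallyFinite G) (hfg : (Subgroup.center G).FG) (hc : CentersDetected G)
    (N : Subgroup G) (hN : N ≤ Subgroup.center G) [N.Normal] : ResiduallyFinite (G ⧸ N) := by
  intro k hk
  induction k using QuotientGroup.induction_on with
  | H h =>
  by_cases hh : h ∈ Subgroup.center G
  · obtain ⟨ι, _, Φ, hΦ⟩ := exists_hom_pi_int_injOn_center hfg
      fun z hz hz1 => hc G (MonoidHom.id G) z hz hz1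
    let π := (QuotientGroup.mk' (N.map Φ)).comp Φ
    have hπ : π h ≠ 1 := by
      intro h1
      obtain ⟨z, hz, hzh⟩ := (QuotientGroup.eq_one_iff _).1 h1
      have h2 := hΦ (z⁻¹ * h) (mul_mem (inv_mem (hN hz)) hh) (by simp [hzh])
      rw [inv_mul_eq_one] at h2
      exact hk ((QuotientGroup.eq_one_iff _).2 (h2 ▸ hz))
    obtain ⟨F, _, _, f, hf⟩ := exists_finite_hom_ne_one_of_fg hπ
    refine ⟨F, inferInstance, inferInstance, QuotientGroup.lift N (f.comp π) fun z hz => ?_, hf⟩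
    have h3 : π z = 1 := (QuotientGroup.eq_one_iff _).2 (Subgroup.mem_map_of_mem Φ hz)
    simp [h3]
  · obtain ⟨g, hg⟩ := not_forall.1 (fun h' => hh (Subgroup.mem_center_iff.2 h'))
    rw [Group.residuallyFinite_iff_exists_finiteIndexNormalSubgroup] at hG
    obtain ⟨M, hM⟩ := hG ((h * g)⁻¹ * (g * h)) fun h1 => hg (inv_mul_eq_one.1 h1).symm
    let P := G ⧸ M.toSubgroup
    have : Finite P := inferInstanceAs (Finite (G ⧸ M.toSubgroup))
    let π : G →* P := QuotientGroup.mk' M.toSubgroup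
    let ρ := (QuotientGroup.mk' (Subgroup.center P)).comp π
    have hρ : ∀ z ∈ N, ρ z = 1 := by
      intro z hz
      refine (QuotientGroup.eq_one_iff _).2 (Subgroup.mem_center_iff.2 fun x => ?_)
      obtain ⟨y, rfl⟩ := QuotientGroup.mk'_surjective M.toSubgroup x
      change π y * π z = π z * π y
      rw [← map_mul, ← map_mul, Subgroup.mem_center_iff.1 (hN hz) y]
    refine exists_finite_hom_ne_one (QuotientGroup.lift N ρ hρ) (k := (h : G ⧸ N)) fun h1 => hM ?_
    have h2 : π h ∈ Subgroup.center P := (QuotientGroup.eq_one_iff _).1 h1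
    have h3 := Subgroup.mem_center_iff.1 h2 (π g)
    rw [← map_mul, ← map_mul] at h3
    exact QuotientGroup.eq.1 h3.symm

/-- Let `H` be any subgroup of a finitely generated right-angled Artin group and
`Z₁` a subgroup of the center of `H` (such a subgroup is automatically normal in
`H`, which is recorded by the instance hypothesis). Then `Z₁` is finitely
generated and `H / Z₁` is residually finite. -/
theorem central_subgroup_fg_and_quotient_residuallyFinite
    {V : Type*} [Fintype V] (Γ : SimpleGraph V)
    (H : Subgroup (RAAG Γ)) (Z₁ : Subgroup H)
    (hZ₁ : Z₁ ≤ Subgroup.center H) [Z₁.Normal] :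
    Z₁.FG ∧ ResiduallyFinite (H ⧸ Z₁) := by
  obtain ⟨h₁, h₂, h₃⟩ :=
    RAAG.residuallyFinite_and_commSubgroupsFG_and_centersDetected (Nat.card V) Γ rfl
  have hinj := H.subtype_injective
  have hfg : ∀ B : Subgroup H, B ≤ Subgroup.center H → B.FG := fun B hB =>
    CommSubgroupsFG.of_injective _ hinj h₂ B fun x hx y _ =>
      (Subgroup.mem_center_iff.1 (hB hx) y).symm
  exact ⟨hfg Z₁ hZ₁, residuallyFinite_quotient_of_le_center (.of_injective _ hinj h₁)
    (hfg _ le_rfl) (.of_injective _ hinj h₃) Z₁ hZ₁⟩
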